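/- Positivity criterion: Let N ≥ 2, 1 < p < N, 0 ≤ s ≤ p, p*(s) = p(N−s)/(N−p), β(s) = ((N−1)p − (p−1)s)/(N−p), R > 0, and for a ∈ [0,1] set V_a(x) = |x|^{−s}(1 − a(|x|/R)^{(N−p)/(p−1)})^{−β(s)}. Define I_a = inf over nonzero u ∈ W_0^{1,p}(B_R) of (∫_{B_R}|∇u|^p dx)/(∫_{B_R}|u|^{p*(s)} V_a(x) dx)^{p/p*(s)}. Then I_a = 0 if and only if a = 1 and 0 ≤ s < p. -/

import Mathlib

open MeasureTheory Metric Set Filter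

noncomputable section

namespace HS

abbrev Euc (N : ℕ) := EuclideanSpace ℝ (Fin N)

/-- smooth compactly supported test functions in the ball `B_R`. -/
def IsTest (N : ℕ) (R : ℝ) (u : Euc N → ℝ) : Prop :=
  ContDiff ℝ (⊤ : ℕ∞) u ∧ HasCompactSupport u ∧ tsupport u ⊆ ball (0 : Euc N) R

/-- a function is radial if it only depends on the norm. -/
def IsRadial {N : ℕ} (u : Euc N → ℝ) : Prop :=
  ∀ x y : Euc N, ‖x‖ = ‖y‖ → u x = u y

/-- the critical Hardy–Sobolev exponent `p*(s) = p(N-s)/(N-p)`. -/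
def pstar (N : ℕ) (p s : ℝ) : ℝ := p * ((N : ℝ) - s) / ((N : ℝ) - p)

/-- the exponent `β(s) = ((N-1)p - (p-1)s)/(N-p)`. -/
def beta (N : ℕ) (p s : ℝ) : ℝ := (((N : ℝ) - 1) * p - (p - 1) * s) / ((N : ℝ) - p)

/-- the potential `V_a(x) = |x|^{-s} (1 - a (|x|/R)^{(N-p)/(p-1)})^{-β(s)}`. -/
def Va (N : ℕ) (p s R a : ℝ) (x : Euc N) : ℝ :=
  ‖x‖ ^ (-s) * (1 - a * (‖x‖ / R) ^ (((N : ℝ) - p) / (p - 1))) ^ (-(beta N p s))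

/-- the gradient energy `∫_{B_R} |∇u|^p`. -/
def gradEn (N : ℕ) (p R : ℝ) (u : Euc N → ℝ) : ℝ :=
  ∫ x in ball (0 : Euc N) R, ‖fderiv ℝ u x‖ ^ p

/-- the denominator `(∫_{B_R} |u|^{p*(s)} V_a)^{p/p*(s)}`. -/
def denomV (N : ℕ) (p s R a : ℝ) (u : Euc N → ℝ) : ℝ :=
  (∫ x in ball (0 : Euc N) R, |u x| ^ pstar N p s * Va N p s R a x) ^ (p / pstar N p s)

/-- the Rayleigh-type quotient for the improved Hardy–Sobolev inequality. -/
def quotV (N : ℕ) (p s R a : ℝ) (u : Euc N → ℝ) : ℝ :=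
  gradEn N p R u / denomV N p s R a u

/-- `I_a` : the infimum of the quotient over nonzero functions of `W_0^{1,p}(B_R)`
(equivalently, by density, over nonzero test functions). -/
def Ia (N : ℕ) (p s R a : ℝ) : ℝ :=
  sInf (quotV N p s R a '' {u | IsTest N R u ∧ u ≠ 0})

/-- `I_{a,rad}` : the infimum of the quotient over nonzero radial functions. -/
def IaRad (N : ℕ) (p s R a : ℝ) : ℝ :=
  sInf (quotV N p s R a '' {u | IsTest N R u ∧ IsRadial u ∧ u ≠ 0})

/-- the best constant `C_{N,p,s}` in the classical Hardy–Sobolev inequality on `ℝ^N`. -/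
def HSC (N : ℕ) (p s : ℝ) : ℝ :=
  sInf ((fun u : Euc N → ℝ =>
      (∫ x : Euc N, ‖fderiv ℝ u x‖ ^ p) /
        (∫ x : Euc N, |u x| ^ pstar N p s * ‖x‖ ^ (-s)) ^ (p / pstar N p s)) ''
    {u : Euc N → ℝ | ContDiff ℝ (⊤ : ℕ∞) u ∧ HasCompactSupport u ∧ u ≠ 0})

/-- `u ∈ W_0^{1,p}(B_R)` with weak gradient `g` : `u` is a limit, in the `W^{1,p}` sense,
of test functions supported in `B_R`. -/
def MemW (N : ℕ) (p R : ℝ) (u : Euc N → ℝ) (g : Euc N → Euc N) : Prop :=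
  ∃ f : ℕ → Euc N → ℝ,
    (∀ n, IsTest N R (f n)) ∧
    Tendsto (fun n => ∫ x in ball (0 : Euc N) R, ‖gradient (f n) x - g x‖ ^ p)
      atTop (nhds (0 : ℝ)) ∧
    Tendsto (fun n => ∫ x in ball (0 : Euc N) R, |f n x - u x| ^ p) atTop (nhds (0 : ℝ))

/-- the quotient for a Sobolev function `u` with weak gradient `g`. -/
def quotW (N : ℕ) (p s R a : ℝ) (u : Euc N → ℝ) (g : Euc N → Euc N) : ℝ :=
  (∫ x in ball (0 : Euc N) R, ‖g x‖ ^ p) / denomV N p s R a u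

/-- a Sobolev function is nonzero if it is not a.e. zero on the ball. -/
def Nonzero (N : ℕ) (R : ℝ) (u : Euc N → ℝ) : Prop :=
  ¬ (u =ᵐ[volume.restrict (ball (0 : Euc N) R)] (fun _ => (0 : ℝ)))

/-- `I_a` is attained by some nonzero function of `W_0^{1,p}(B_R)`. -/
def Attained (N : ℕ) (p s R a : ℝ) : Prop :=
  ∃ u g, MemW N p R u g ∧ Nonzero N R u ∧ quotW N p s R a u g = Ia N p s R a

end HS

namespace HS

lemma integral_euler {N : ℕ} {v : Euc N → ℝ} (hv : ContDiff ℝ 1 v) (hc : HasCompactSupport v) :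
    ∫ x, ((N : ℝ) * v x + fderiv ℝ v x x) = 0 := by
  have hdc : Continuous (fderiv ℝ v) := hv.continuous_fderiv one_ne_zero
  have hint (i : Fin N) : Integrable
      (fun x : Euc N => fderiv ℝ v x (EuclideanSpace.single i 1) * x i) := by
    refine Continuous.integrable_of_hasCompactSupport (by fun_prop) ?_
    refine (hc.fderiv ℝ).mono fun x hx => ?_
    contrapose! hx
    simp only [Function.mem_support, not_not] at hx ⊢
    simp [hx]
  have hvi : Integrable v := hv.continuous.integrable_of_hasCompactSupport hc
  have key (i : Fin N) :
      ∫ x, v x = -∫ x : Euc N, fderiv ℝ v x (EuclideanSpace.single i 1) * x i := by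
    have hproj (x : Euc N) : HasFDerivAt (fun x : Euc N => x i)
        (EuclideanSpace.proj i : Euc N →L[ℝ] ℝ) x :=
      (EuclideanSpace.proj i : Euc N →L[ℝ] ℝ).hasFDerivAt
    have hone (x : Euc N) :
        fderiv ℝ (fun x : Euc N => x i) x (EuclideanSpace.single i 1) = 1 := by
      rw [(hproj x).fderiv]; simp
    have := integral_mul_fderiv_eq_neg_fderiv_mul_of_integrable (μ := (volume : Measure (Euc N)))
      (f := v) (g := fun x : Euc N => x i) (v := EuclideanSpace.single i 1) (hint i)
      (by simpa [hone] using hvi)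
      ((by fun_prop : Continuous fun x : Euc N => v x * x i).integrable_of_hasCompactSupport
        hc.mul_right)
      (fun x _ => hv.differentiable one_ne_zero x) (fun x _ => (hproj x).differentiableAt)
    simpa [hone] using this
  have hsum (x : Euc N) : fderiv ℝ v x x =
      ∑ i, fderiv ℝ v x (EuclideanSpace.single i 1) * x i := by
    have hx : fderiv ℝ v x x =
        fderiv ℝ v x (∑ i, (EuclideanSpace.basisFun (Fin N) ℝ).repr x i •
          EuclideanSpace.basisFun (Fin N) ℝ i) := by
      rw [(EuclideanSpace.basisFun (Fin N) ℝ).sum_repr x]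
    rw [hx, map_sum]
    refine Finset.sum_congr rfl fun i _ => ?_
    simp [mul_comm]
  simp_rw [hsum]
  rw [integral_add (hvi.const_mul _) (integrable_finsetSum _ fun i _ => hint i),
    integral_finsetSum _ fun i _ => hint i, integral_const_mul]
  have : ∑ i : Fin N, ∫ x : Euc N, fderiv ℝ v x (EuclideanSpace.single i 1) * x i =
      ∑ _i : Fin N, -∫ x, v x := Finset.sum_congr rfl fun i _ => by rw [key i, neg_neg]
  rw [this]
  simp

lemma contDiff_mul_of_tsupport_subset {E : Type*} [NormedAddCommGroup E] [NormedSpace ℝ E]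
    {f g : E → ℝ} {U : Set E} (hf : ContDiff ℝ 1 f) (hU : tsupport f ⊆ U)
    (hg : ∀ x ∈ U, ContDiffAt ℝ 1 g x) : ContDiff ℝ 1 fun x => f x * g x := by
  rw [contDiff_iff_contDiffAt]
  intro x
  by_cases hx : x ∈ tsupport f
  · exact hf.contDiffAt.mul (hg x (hU hx))
  · have : (fun x => f x * g x) =ᶠ[nhds x] fun _ => 0 := by
      filter_upwards [notMem_tsupport_iff_eventuallyEq.1 hx] with y hy
      simp [hy]
    exact contDiffAt_const.congr_of_eventuallyEq this

lemma young_rpow {A B δ p : ℝ} (hA : 0 ≤ A) (hB : 0 ≤ B) (hδ : 0 < δ) (hp : 1 < p) :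
    p * A ^ (p - 1) * B ≤ δ * A ^ p + p * (p / δ) ^ (p - 1) * B ^ p := by
  have hp0 : 0 < p := by linarith
  have split {t : ℝ} (ht : 0 ≤ t) : t ^ p = t ^ (p - 1) * t := by
    rw [← Real.rpow_add_one' ht (by linarith)]; congr 1; ring
  rcases le_total (p * B) (δ * A) with h | h
  · have h1 : p * A ^ (p - 1) * B ≤ δ * A ^ p := by
      rw [split hA]
      nlinarith [mul_le_mul_of_nonneg_left h (Real.rpow_nonneg hA (p - 1))]
    have : 0 ≤ p * (p / δ) ^ (p - 1) * B ^ p := by positivity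
    linarith
  · have h2 : A ≤ p / δ * B := by
      rw [div_mul_eq_mul_div, le_div_iff₀ hδ]; linarith
    have h3 : A ^ (p - 1) ≤ (p / δ) ^ (p - 1) * B ^ (p - 1) := by
      rw [← Real.mul_rpow (by positivity) hB]
      exact Real.rpow_le_rpow hA h2 (by linarith)
    have h4 : p * A ^ (p - 1) * B ≤ p * (p / δ) ^ (p - 1) * B ^ p := by
      rw [split hB]
      have := mul_le_mul_of_nonneg_left (mul_le_mul_of_nonneg_right h3 hB) hp0.le
      linarith
    have : 0 ≤ δ * A ^ p := by positivity
    linarith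

/-- A regularised version of the weight `|x|^{-p} (R² - |x|²)^{-q}`. -/
def regWeight (N : ℕ) (p q R ε : ℝ) (x : Euc N) : ℝ :=
  (‖x‖ ^ 2 + ε) ^ (-p / 2) * (R ^ 2 - ‖x‖ ^ 2) ^ (-q)

lemma sq_sub_sq_pos {N : ℕ} {R : ℝ} {x : Euc N} (hx : x ∈ ball (0 : Euc N) R) :
    0 < R ^ 2 - ‖x‖ ^ 2 := by
  have := mem_ball_zero_iff.1 hx
  nlinarith [norm_nonneg x]

lemma contDiffAt_regWeight {N : ℕ} {p q R ε : ℝ} (hε : 0 < ε) {x : Euc N}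
    (hx : x ∈ ball (0 : Euc N) R) : ContDiffAt ℝ 1 (regWeight N p q R ε) x := by
  have hn : ContDiffAt ℝ 1 (fun x : Euc N => ‖x‖ ^ 2) x := (contDiff_norm_sq ℝ).contDiffAt
  exact ((hn.add contDiffAt_const).rpow_const_of_ne (by positivity)).mul
    ((contDiffAt_const.sub hn).rpow_const_of_ne (sq_sub_sq_pos hx).ne')

lemma IsTest.contDiff_one {N : ℕ} {R : ℝ} {u : Euc N → ℝ} (hu : IsTest N R u) :
    ContDiff ℝ 1 u := hu.1.of_le (by exact_mod_cast le_top)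

lemma contDiff_abs_rpow_mul_regWeight {N : ℕ} {p q R ε : ℝ} (hp : 1 < p) (hε : 0 < ε)
    {u : Euc N → ℝ} (hu : IsTest N R u) :
    ContDiff ℝ 1 fun x => |u x| ^ p * regWeight N p q R ε x := by
  refine contDiff_mul_of_tsupport_subset (hu.contDiff_one.norm_rpow hp) (U := ball 0 R) ?_
    fun x hx => contDiffAt_regWeight hε hx
  refine (closure_mono fun x hx => ?_).trans hu.2.2
  contrapose! hx
  simp only [Function.mem_support, not_not] at hx ⊢
  simp [hx, Real.zero_rpow (by linarith : p ≠ 0)]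

lemma hasCompactSupport_abs_rpow_mul {N : ℕ} {p R : ℝ} (hp : 0 < p)
    {u : Euc N → ℝ} (hu : IsTest N R u) (g : Euc N → ℝ) :
    HasCompactSupport fun x => |u x| ^ p * g x := by
  refine hu.2.1.mono fun x hx => ?_
  contrapose! hx
  simp only [Function.mem_support, not_not] at hx ⊢
  simp [hx, Real.zero_rpow hp.ne']

lemma euler_regWeight_ge {N : ℕ} {p R ε c : ℝ} (hp : 1 < p) (hcN : c ≤ N - p)
    (hcp : c ≤ 2 * (p - 1)) (hc : 0 < c) (hR : 0 < R) (hε : 0 < ε) {u : Euc N → ℝ}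
    {x : Euc N} (hu : DifferentiableAt ℝ u x) (hx : x ∈ ball (0 : Euc N) R) :
    c * R ^ 2 / 2 * (|u x| ^ p * regWeight N p p R ε x)
      - p * (p / (c * R ^ 2 / 2)) ^ (p - 1) * ‖fderiv ℝ u x‖ ^ p ≤
    N * (|u x| ^ p * regWeight N p (p - 1) R ε x) +
      fderiv ℝ (fun x => |u x| ^ p * regWeight N p (p - 1) R ε x) x x := by
  have hp0 : 0 < p := by linarith
  have hQ := sq_sub_sq_pos hx
  have hn : HasFDerivAt (fun x : Euc N => ‖x‖ ^ 2) (2 • innerSL ℝ x) x :=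
    (hasStrictFDerivAt_norm_sq x).hasFDerivAt
  have hP : 0 < ‖x‖ ^ 2 + ε := by positivity
  have hu' := (hasDerivAt_abs_rpow (u x) hp).comp_hasFDerivAt x hu.hasFDerivAt
  have hP' := ((hn.add_const ε).rpow_const (p := -p / 2) (Or.inl hP.ne'))
  have hQ' := ((hn.const_sub (R ^ 2)).rpow_const (p := -(p - 1)) (Or.inl hQ.ne'))
  have hv := hu'.mul (hP'.mul hQ')
  have hfd : fderiv ℝ (fun x => |u x| ^ p * regWeight N p (p - 1) R ε x) x = _ := hv.fderiv
  rw [hfd]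
  have hw : regWeight N p (p - 1) R ε x = (‖x‖ ^ 2 + ε) ^ (-p / 2) *
    (R ^ 2 - ‖x‖ ^ 2) ^ (-(p - 1)) := rfl
  have hw' : regWeight N p p R ε x = (‖x‖ ^ 2 + ε) ^ (-p / 2) *
    (R ^ 2 - ‖x‖ ^ 2) ^ (-p) := rfl
  rw [hw, hw']
  have hQpow : (R ^ 2 - ‖x‖ ^ 2) ^ (-(p - 1)) =
      (R ^ 2 - ‖x‖ ^ 2) * (R ^ 2 - ‖x‖ ^ 2) ^ (-p) := by
    rw [mul_comm, ← Real.rpow_add_one hQ.ne']; congr 1; ring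
  have hQpow' : (R ^ 2 - ‖x‖ ^ 2) ^ (-(p - 1) - 1) = (R ^ 2 - ‖x‖ ^ 2) ^ (-p) := by
    congr 1; ring
  have hPpow : (‖x‖ ^ 2 + ε) ^ (-p / 2 - 1) = (‖x‖ ^ 2 + ε) ^ (-p / 2) / (‖x‖ ^ 2 + ε) :=
    Real.rpow_sub_one hP.ne' _
  have hUpow : |u x| ^ (p - 1) = |u x| ^ (p - 2) * |u x| := by
    rcases eq_or_ne (u x) 0 with h | h
    · simp [h, Real.zero_rpow (by linarith : p - 1 ≠ 0)]
    · rw [← Real.rpow_add_one (abs_pos.2 h).ne']; congr 1; ring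
  set G : ℝ := (‖x‖ ^ 2 + ε) ^ (-1 / 2 : ℝ) * (R ^ 2 - ‖x‖ ^ 2)⁻¹ with hG
  have hGpos : 0 < G := by positivity
  have hGp : G ^ p = (‖x‖ ^ 2 + ε) ^ (-p / 2) * (R ^ 2 - ‖x‖ ^ 2) ^ (-p) := by
    rw [hG, Real.mul_rpow (by positivity) (by positivity), ← Real.rpow_mul hP.le,
      Real.inv_rpow hQ.le, Real.rpow_neg hQ.le]
    congr 2; ring
  have hGinv : ‖x‖ * (R ^ 2 - ‖x‖ ^ 2) ≤ G⁻¹ := by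
    rw [hG, mul_inv, inv_inv, ← Real.rpow_neg hP.le]
    refine mul_le_mul_of_nonneg_right ?_ hQ.le
    rw [show -(-1 / 2 : ℝ) = 1 / 2 by norm_num, ← Real.sqrt_eq_rpow]
    exact Real.le_sqrt_of_sq_le (by linarith)
  have hGp1 : G ^ p * G⁻¹ = G ^ (p - 1) := by
    rw [Real.rpow_sub_one hGpos.ne']; rfl
  have hD : |fderiv ℝ u x x| ≤ ‖fderiv ℝ u x‖ * ‖x‖ := (fderiv ℝ u x).le_opNorm x
  have hY := young_rpow (A := |u x| * G) (B := ‖fderiv ℝ u x‖) (δ := c * R ^ 2 / 2) (p := p)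
    (by positivity) (norm_nonneg _) (by positivity) hp
  rw [Real.mul_rpow (abs_nonneg _) hGpos.le, Real.mul_rpow (abs_nonneg _) hGpos.le] at hY
  have hcross : -(p * (|u x| ^ (p - 1) * G ^ (p - 1)) * ‖fderiv ℝ u x‖) ≤
      p * |u x| ^ (p - 2) * u x * fderiv ℝ u x x * (G ^ p * (R ^ 2 - ‖x‖ ^ 2)) := by
    refine neg_le_of_abs_le ?_
    rw [abs_mul, abs_mul, abs_mul, abs_of_nonneg (by positivity : 0 ≤ p * |u x| ^ (p - 2)),
      abs_of_nonneg (by positivity : 0 ≤ G ^ p * (R ^ 2 - ‖x‖ ^ 2)), hUpow, ← hGp1]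
    calc p * |u x| ^ (p - 2) * |u x| * |fderiv ℝ u x x| * (G ^ p * (R ^ 2 - ‖x‖ ^ 2))
        ≤ p * |u x| ^ (p - 2) * |u x| * (‖fderiv ℝ u x‖ * ‖x‖) *
            (G ^ p * (R ^ 2 - ‖x‖ ^ 2)) := by gcongr
      _ = p * |u x| ^ (p - 2) * |u x| * ‖fderiv ℝ u x‖ * G ^ p *
            (‖x‖ * (R ^ 2 - ‖x‖ ^ 2)) := by ring
      _ ≤ p * |u x| ^ (p - 2) * |u x| * ‖fderiv ℝ u x‖ * G ^ p * G⁻¹ := by gcongr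
      _ = _ := by ring
  have hdiv : c * R ^ 2 ≤ N * (R ^ 2 - ‖x‖ ^ 2) -
      p * ‖x‖ ^ 2 * (R ^ 2 - ‖x‖ ^ 2) / (‖x‖ ^ 2 + ε) + 2 * (p - 1) * ‖x‖ ^ 2 := by
    have h1 : p * ‖x‖ ^ 2 * (R ^ 2 - ‖x‖ ^ 2) / (‖x‖ ^ 2 + ε) ≤ p * (R ^ 2 - ‖x‖ ^ 2) := by
      rw [div_le_iff₀ hP]
      nlinarith [mul_pos (mul_pos hp0 hQ) hε]
    nlinarith [mul_le_mul_of_nonneg_right hcN hQ.le,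
      mul_le_mul_of_nonneg_right hcp (sq_nonneg ‖x‖)]
  have hmain := mul_le_mul_of_nonneg_left hdiv
    (by positivity : 0 ≤ |u x| ^ p * G ^ p)
  simp only [Pi.mul_apply, Function.comp_apply, _root_.add_apply, _root_.smul_apply,
    innerSL_apply_apply, real_inner_self_eq_norm_sq, smul_eq_mul, nsmul_eq_mul,
    _root_.neg_apply]
  rw [hQpow, hQpow', hPpow, ← hGp]
  rw [hGp] at hmain hcross hY ⊢
  simp only [div_eq_mul_inv] at *
  push_cast
  linarith

lemma IsTest.continuous_norm_fderiv_rpow {N : ℕ} {p R : ℝ} (hp : 0 < p) {u : Euc N → ℝ}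
    (hu : IsTest N R u) : Continuous fun x => ‖fderiv ℝ u x‖ ^ p :=
  ((hu.contDiff_one.continuous_fderiv one_ne_zero).norm).rpow_const fun _ => Or.inr hp.le

lemma IsTest.integrable_norm_fderiv_rpow {N : ℕ} {p R : ℝ} (hp : 0 < p) {u : Euc N → ℝ}
    (hu : IsTest N R u) : Integrable fun x => ‖fderiv ℝ u x‖ ^ p := by
  refine (hu.continuous_norm_fderiv_rpow hp).integrable_of_hasCompactSupport ?_
  refine (hu.2.1.fderiv ℝ).mono fun x hx => ?_
  contrapose! hx
  simp only [Function.mem_support, not_not] at hx ⊢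
  simp [hx, Real.zero_rpow hp.ne']

lemma IsTest.eq_zero {N : ℕ} {R : ℝ} {u : Euc N → ℝ} (hu : IsTest N R u) {x : Euc N}
    (hx : x ∉ ball (0 : Euc N) R) : u x = 0 :=
  image_eq_zero_of_notMem_tsupport fun h => hx (hu.2.2 h)

lemma IsTest.fderiv_eq_zero {N : ℕ} {R : ℝ} {u : Euc N → ℝ} (hu : IsTest N R u) {x : Euc N}
    (hx : x ∉ ball (0 : Euc N) R) : fderiv ℝ u x = 0 := by
  rw [(notMem_tsupport_iff_eventuallyEq.1 fun h => hx (hu.2.2 h)).fderiv_eq]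
  simp

lemma IsTest.gradEn_eq {N : ℕ} {p R : ℝ} (hp : 0 < p) {u : Euc N → ℝ} (hu : IsTest N R u) :
    gradEn N p R u = ∫ x, ‖fderiv ℝ u x‖ ^ p :=
  setIntegral_eq_integral_of_forall_compl_eq_zero fun x hx => by
    simp [hu.fderiv_eq_zero hx, Real.zero_rpow hp.ne']

lemma hardy_regWeight {N : ℕ} {p R : ℝ} (hp : 1 < p) (hpN : p < N) (hR : 0 < R) :
    ∃ C : ℝ, 0 < C ∧ ∀ ε > 0, ∀ u, IsTest N R u →
      ∫ x, |u x| ^ p * regWeight N p p R ε x ≤ C * gradEn N p R u := by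
  have hp0 : 0 < p := by linarith
  set c : ℝ := min (N - p) (2 * (p - 1)) with hcdef
  have hc : 0 < c := lt_min (by linarith) (by linarith)
  refine ⟨p * (p / (c * R ^ 2 / 2)) ^ (p - 1) / (c * R ^ 2 / 2), by positivity,
    fun ε hε u hu => ?_⟩
  rw [hu.gradEn_eq hp0, div_mul_eq_mul_div, le_div_iff₀ (by positivity), mul_comm]
  set v : Euc N → ℝ := fun x => |u x| ^ p * regWeight N p (p - 1) R ε x with hv
  have hvd : ContDiff ℝ 1 v := contDiff_abs_rpow_mul_regWeight hp hε hu
  have hvc : HasCompactSupport v := hasCompactSupport_abs_rpow_mul hp0 hu _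
  have hA : Integrable fun x => |u x| ^ p * regWeight N p p R ε x :=
    (contDiff_abs_rpow_mul_regWeight hp hε hu).continuous.integrable_of_hasCompactSupport
      (hasCompactSupport_abs_rpow_mul hp0 hu _)
  have hB := hu.integrable_norm_fderiv_rpow hp0
  have hE : Integrable fun x => (N : ℝ) * v x + fderiv ℝ v x x := by
    have hdc : Continuous (fderiv ℝ v) := hvd.continuous_fderiv one_ne_zero
    refine Continuous.integrable_of_hasCompactSupport
      (by have := hvd.continuous; fun_prop) (hvc.mul_left.add ?_)
    refine (hvc.fderiv ℝ).mono fun x hx => ?_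
    contrapose! hx
    simp only [Function.mem_support, not_not] at hx ⊢
    simp [hx]
  have hle := integral_mono ((hA.const_mul (c * R ^ 2 / 2)).sub
    (hB.const_mul (p * (p / (c * R ^ 2 / 2)) ^ (p - 1)))) hE fun x => by
      by_cases hx : x ∈ ball (0 : Euc N) R
      · exact euler_regWeight_ge hp (min_le_left _ _) (min_le_right _ _) hc hR hε
          (hu.contDiff_one.differentiable one_ne_zero x) hx
      · have hv0 : fderiv ℝ v x = 0 := by
          have : v =ᶠ[nhds x] fun _ => 0 := by
            filter_upwards [notMem_tsupport_iff_eventuallyEq.1 fun h => hx (hu.2.2 h)] with y hy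
            simp [hv, hy, Real.zero_rpow hp0.ne']
          rw [this.fderiv_eq]; simp
        have hvx : v x = 0 := by simp [hv, hu.eq_zero hx, Real.zero_rpow hp0.ne']
        rw [hv0, hvx]
        simp [hu.eq_zero hx, hu.fderiv_eq_zero hx, Real.zero_rpow hp0.ne']
  rw [integral_euler hvd hvc] at hle
  simp only [Pi.sub_apply] at hle
  rw [integral_sub (hA.const_mul _) (hB.const_mul _), integral_const_mul,
    integral_const_mul] at hle
  linarith

/-- A Hardy inequality with a weight singular both at the origin and on the boundary. -/
lemma hardy_lintegral {N : ℕ} {p R : ℝ} (hp : 1 < p) (hpN : p < N) (hR : 0 < R) :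
    ∃ C : ℝ, 0 < C ∧ ∀ u, IsTest N R u →
      ∫⁻ x, ENNReal.ofReal (|u x| ^ p * (‖x‖ ^ (-p) * (R ^ 2 - ‖x‖ ^ 2) ^ (-p))) ≤
        ENNReal.ofReal (C * gradEn N p R u) := by
  have hp0 : 0 < p := by linarith
  obtain ⟨C, hC, h⟩ := hardy_regWeight hp hpN hR
  refine ⟨C, hC, fun u hu => ?_⟩
  have hε (n : ℕ) : 0 < 1 / ((n : ℝ) + 1) := by positivity
  have hcont (n : ℕ) := (contDiff_abs_rpow_mul_regWeight (q := p) hp (hε n) hu).continuous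
  set F : ℕ → Euc N → ENNReal := fun n x =>
    ENNReal.ofReal (|u x| ^ p * regWeight N p p R (1 / ((n : ℝ) + 1)) x) with hF
  have hbound (n : ℕ) : ∫⁻ x, F n x ≤ ENNReal.ofReal (C * gradEn N p R u) := by
    rw [← ofReal_integral_eq_lintegral_ofReal]
    · exact ENNReal.ofReal_le_ofReal (h _ (hε n) u hu)
    · exact (hcont n).integrable_of_hasCompactSupport (hasCompactSupport_abs_rpow_mul hp0 hu _)
    · refine Eventually.of_forall fun x => ?_
      by_cases hx : x ∈ ball (0 : Euc N) R
      · have := sq_sub_sq_pos hx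
        simp only [regWeight, Pi.zero_apply]
        have := hε n
        positivity
      · simp [hu.eq_zero hx, Real.zero_rpow hp0.ne']
  calc _ ≤ ∫⁻ x, liminf (fun n => F n x) atTop := by
        refine lintegral_mono fun x => ?_
        rcases eq_or_ne x 0 with rfl | hx
        · simp [Real.zero_rpow (neg_ne_zero.2 hp0.ne')]
        · refine (Tendsto.liminf_eq ?_).ge
          refine ENNReal.tendsto_ofReal (Tendsto.const_mul _ ?_)
          refine Tendsto.mul_const _ ?_
          have hx' : 0 < ‖x‖ := norm_pos_iff.2 hx
          have h1 : Tendsto (fun n : ℕ => ‖x‖ ^ 2 + 1 / ((n : ℝ) + 1)) atTop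
              (nhds (‖x‖ ^ 2 + 0)) := tendsto_const_nhds.add tendsto_one_div_add_atTop_nhds_zero_nat
          have h2 := h1.rpow_const (p := -p / 2) (Or.inl (by positivity))
          convert h2 using 2
          rw [add_zero, ← Real.rpow_natCast, ← Real.rpow_mul hx'.le]
          congr 1; push_cast; ring
    _ ≤ liminf (fun n => ∫⁻ x, F n x) atTop :=
        lintegral_liminf_le fun n => ((hcont n).measurable).ennreal_ofReal
    _ ≤ _ := liminf_le_of_le (by isBoundedDefault) fun b hb => by
        obtain ⟨n, hn⟩ := hb.exists
        exact hn.trans (hbound n)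

/-- The Sobolev inequality in terms of lower Lebesgue integrals. -/
lemma sobolev_lintegral {N : ℕ} {p R : ℝ} (hN : 2 ≤ N) (hp : 1 < p) (hpN : p < N) :
    ∃ C : ℝ, 0 < C ∧ ∀ u, IsTest N R u →
      ∫⁻ x, ENNReal.ofReal (|u x| ^ (p * N / (N - p))) ≤
        ENNReal.ofReal (C * gradEn N p R u ^ ((N : ℝ) / (N - p))) := by
  have hp0 : 0 < p := by linarith
  have hNp : 0 < (N : ℝ) - p := by linarith
  have hN0 : (0 : ℝ) < N := by linarith
  set q : ℝ := p * N / (N - p) with hq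
  have hq0 : 0 < q := by positivity
  lift p to NNReal using hp0.le
  have hqe : ∃ q' : NNReal, (q' : ℝ) = q := ⟨⟨q, hq0.le⟩, rfl⟩
  obtain ⟨q', hq'⟩ := hqe
  set K := SNormLESNormFDerivOfEqConst ℝ (volume : Measure (Euc N)) p with hK
  refine ⟨(K : ℝ) ^ q + 1, by positivity, fun u hu => ?_⟩
  have hS := eLpNorm_le_eLpNorm_fderiv_of_eq (μ := (volume : Measure (Euc N)))
    hu.contDiff_one hu.2.1 (p := p) (p' := q') (by exact_mod_cast hp.le)
    (by simp; omega) (by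
      rw [hq', hq]
      simp only [finrank_euclideanSpace, Fintype.card_fin]
      push_cast
      field_simp)
  rw [eLpNorm_eq_lintegral_rpow_enorm_toReal (by simpa using fun h => by simp [h] at hq'; linarith)
    (by simp), eLpNorm_eq_lintegral_rpow_enorm_toReal (by simpa using fun h => by simp [h] at hp0)
    (by simp)] at hS
  simp only [ENNReal.coe_toReal, hq'] at hS
  have hG : ∫⁻ x, ‖fderiv ℝ u x‖ₑ ^ (p : ℝ) = ENNReal.ofReal (gradEn N p R u) := by
    rw [hu.gradEn_eq hp0, ofReal_integral_eq_lintegral_ofReal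
      (hu.integrable_norm_fderiv_rpow hp0) (Eventually.of_forall fun x => by positivity)]
    refine lintegral_congr fun x => ?_
    rw [← ENNReal.ofReal_rpow_of_nonneg (norm_nonneg _) hp0.le, ofReal_norm]
  have hL : ∫⁻ x, ‖u x‖ₑ ^ q = ∫⁻ x, ENNReal.ofReal (|u x| ^ q) := by
    refine lintegral_congr fun x => ?_
    rw [← ENNReal.ofReal_rpow_of_nonneg (abs_nonneg _) hq0.le, ← Real.norm_eq_abs, ofReal_norm]
  have hE0 : 0 ≤ gradEn N p R u := integral_nonneg fun x => by positivity
  rw [hG, hL, ← hK] at hS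
  have hS' := ENNReal.rpow_le_rpow hS hq0.le
  rw [← ENNReal.rpow_mul, one_div_mul_cancel hq0.ne', ENNReal.rpow_one,
    ENNReal.mul_rpow_of_nonneg _ _ hq0.le, ← ENNReal.rpow_mul,
    ENNReal.ofReal_rpow_of_nonneg hE0 (by positivity), ← ENNReal.ofReal_coe_nnreal,
    ENNReal.ofReal_rpow_of_nonneg K.coe_nonneg hq0.le, ← ENNReal.ofReal_mul (by positivity)] at hS'
  refine hS'.trans (ENNReal.ofReal_le_ofReal ?_)
  rw [show 1 / (p : ℝ) * q = N / (N - p) by rw [hq]; field_simp]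
  gcongr
  linarith

lemma one_sub_rpow_ge {α t : ℝ} (hα : 0 < α) (ht : 0 ≤ t) (ht1 : t ≤ 1) :
    min 1 (α / 2) * (1 - t ^ 2) ≤ 1 - t ^ α := by
  have ht2 : t ^ 2 ≤ 1 := pow_le_one₀ ht ht1
  rcases le_total 2 α with h | h
  · have h1 : t ^ α ≤ t ^ 2 := by
      rw [← Real.rpow_natCast t 2]
      rcases ht.eq_or_lt with rfl | h0
      · simp [Real.zero_rpow hα.ne']
      · exact Real.rpow_le_rpow_of_exponent_ge h0 ht1 (by exact_mod_cast h)
    nlinarith [min_le_left 1 (α / 2)]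
  · have h1 : t ^ α = (1 + (t ^ 2 - 1)) ^ (α / 2) := by
      rw [show 1 + (t ^ 2 - 1) = t ^ 2 by ring, ← Real.rpow_natCast t 2, ← Real.rpow_mul ht]
      congr 1; push_cast; ring
    have h2 := rpow_one_add_le_one_add_mul_self (s := t ^ 2 - 1) (p := α / 2)
      (by nlinarith [sq_nonneg t]) (by linarith) (by linarith)
    rw [h1]
    nlinarith [min_le_right 1 (α / 2)]

lemma one_sub_rpow_le {α t : ℝ} (ht : 0 ≤ t) (ht1 : t ≤ 1) :
    1 - t ^ α ≤ max 1 α * (1 - t) := by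
  rcases le_total 1 α with h | h
  · have h2 := one_add_mul_self_le_rpow_one_add (s := t - 1) (by linarith) h
    rw [show 1 + (t - 1) = t by ring] at h2
    nlinarith [le_max_right 1 α]
  · have h1 : t ≤ t ^ α := by
      rcases ht.eq_or_lt with rfl | h0
      · exact Real.rpow_nonneg le_rfl _
      · simpa using Real.rpow_le_rpow_of_exponent_ge h0 ht1 h
    nlinarith [le_max_left 1 α]

section Weight

variable {N : ℕ} {p s R a : ℝ}

lemma ratio_rpow_lt_one (hp : 1 < p) (hpN : p < N) (hR : 0 < R) {x : Euc N}
    (hx : x ∈ ball (0 : Euc N) R) : (‖x‖ / R) ^ (((N : ℝ) - p) / (p - 1)) < 1 := by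
  refine Real.rpow_lt_one (by positivity) ?_ (div_pos (by linarith) (by linarith))
  rw [div_lt_one hR]
  exact mem_ball_zero_iff.1 hx

lemma weight_base_pos (hp : 1 < p) (hpN : p < N) (hR : 0 < R) (ha : a ∈ Icc (0 : ℝ) 1)
    {x : Euc N} (hx : x ∈ ball (0 : Euc N) R) :
    0 < 1 - a * (‖x‖ / R) ^ (((N : ℝ) - p) / (p - 1)) := by
  have h1 := ratio_rpow_lt_one hp hpN hR hx
  have h0 : 0 ≤ (‖x‖ / R) ^ (((N : ℝ) - p) / (p - 1)) := by positivity
  nlinarith [ha.1, ha.2]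

lemma Va_nonneg (hp : 1 < p) (hpN : p < N) (hR : 0 < R) (ha : a ∈ Icc (0 : ℝ) 1)
    {x : Euc N} (hx : x ∈ ball (0 : Euc N) R) : 0 ≤ Va N p s R a x := by
  have := weight_base_pos hp hpN hR ha hx
  unfold Va
  positivity

lemma beta_pos (hp : 1 < p) (hpN : p < N) (hsp : s ≤ p) : 0 < beta N p s :=
  div_pos (by nlinarith) (by linarith)

lemma pstar_pos (hp : 1 < p) (hpN : p < N) (hsp : s ≤ p) : 0 < pstar N p s :=
  div_pos (by nlinarith) (by linarith)

lemma Va_le_of_lt_one (hp : 1 < p) (hpN : p < N) (hsp : s ≤ p) (hR : 0 < R)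
    (ha0 : 0 ≤ a) (ha1 : a < 1) {x : Euc N} (hx : x ∈ ball (0 : Euc N) R) :
    Va N p s R a x ≤ (1 - a) ^ (-beta N p s) * ‖x‖ ^ (-s) := by
  have h1 := ratio_rpow_lt_one hp hpN hR hx
  rw [Va, mul_comm]
  refine mul_le_mul_of_nonneg_right ?_ (by positivity)
  refine Real.rpow_le_rpow_of_nonpos (by linarith) ?_ (by linarith [beta_pos hp hpN hsp])
  nlinarith

lemma exists_Va_le (hp : 1 < p) (hpN : p < N) (hR : 0 < R) (ha : a ∈ Icc (0 : ℝ) 1) :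
    ∃ C : ℝ, 0 < C ∧ ∀ x ∈ ball (0 : Euc N) R,
      Va N p p R a x ≤ C * (‖x‖ ^ (-p) * (R ^ 2 - ‖x‖ ^ 2) ^ (-p)) := by
  set α : ℝ := ((N : ℝ) - p) / (p - 1) with hα
  have hα0 : 0 < α := div_pos (by linarith) (by linarith)
  set c : ℝ := min 1 (α / 2) with hc
  have hc0 : 0 < c := lt_min one_pos (by positivity)
  have hbeta : beta N p p = p := by
    rw [beta, div_eq_iff (by linarith)]; ring
  refine ⟨(c / R ^ 2) ^ (-p), by positivity, fun x hx => ?_⟩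
  have hQ := sq_sub_sq_pos hx
  have hxR := mem_ball_zero_iff.1 hx
  have h1 := one_sub_rpow_ge hα0 (t := ‖x‖ / R) (by positivity) ((div_le_one hR).2 hxR.le)
  have h2 : c * (1 - (‖x‖ / R) ^ 2) = c / R ^ 2 * (R ^ 2 - ‖x‖ ^ 2) := by
    field_simp
  rw [← hc, h2] at h1
  have h0 : 0 ≤ (‖x‖ / R) ^ α := by positivity
  rw [Va, hbeta, mul_left_comm, ← Real.mul_rpow (by positivity) hQ.le]
  refine mul_le_mul_of_nonneg_left ?_ (by positivity)
  exact Real.rpow_le_rpow_of_nonpos (by positivity) (by nlinarith [ha.2]) (by linarith)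

lemma measurable_Va : Measurable (Va N p s R a) := by
  unfold Va
  fun_prop

end Weight

lemma hardySobolev_lintegral {N : ℕ} {p s R : ℝ} (hN : 2 ≤ N) (hp : 1 < p) (hpN : p < N)
    (hs : 0 ≤ s) (hsp : s ≤ p) (hR : 0 < R) :
    ∃ C : ℝ, 0 < C ∧ ∀ u, IsTest N R u →
      ∫⁻ x, ENNReal.ofReal (|u x| ^ pstar N p s * ‖x‖ ^ (-s)) ≤
        ENNReal.ofReal (C * gradEn N p R u ^ (pstar N p s / p)) := by
  have hp0 : 0 < p := by linarith
  have hNp : 0 < (N : ℝ) - p := by linarith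
  have hN0 : (0 : ℝ) < N := by linarith
  obtain ⟨C₁, hC₁, h₁⟩ := hardy_lintegral hp hpN hR
  obtain ⟨C₂, hC₂, h₂⟩ := sobolev_lintegral (R := R) hN hp hpN
  set θ : ℝ := s / p with hθ
  have hθ0 : 0 ≤ θ := by positivity
  have hθ1 : 0 ≤ 1 - θ := by
    rw [sub_nonneg]; exact (div_le_one hp0).2 hsp
  refine ⟨((R ^ 2) ^ p * C₁) ^ θ * C₂ ^ (1 - θ), by positivity, fun u hu => ?_⟩
  have hE0 : 0 ≤ gradEn N p R u := integral_nonneg fun x => by positivity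
  have hum : Measurable u := hu.1.continuous.measurable
  have hhardy : ∫⁻ x, ENNReal.ofReal (|u x| ^ p * ‖x‖ ^ (-p)) ≤
      ENNReal.ofReal ((R ^ 2) ^ p * C₁ * gradEn N p R u) := by
    rw [mul_assoc, ENNReal.ofReal_mul (by positivity)]
    refine le_trans ?_ (mul_le_mul_right (h₁ u hu) _)
    rw [← lintegral_const_mul' _ _ ENNReal.ofReal_ne_top]
    refine lintegral_mono fun x => ?_
    rw [← ENNReal.ofReal_mul (by positivity)]
    refine ENNReal.ofReal_le_ofReal ?_
    by_cases hx : x ∈ ball (0 : Euc N) R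
    · have hQ := sq_sub_sq_pos hx
      have h : 1 ≤ (R ^ 2) ^ p * (R ^ 2 - ‖x‖ ^ 2) ^ (-p) := by
        rw [Real.rpow_neg hQ.le, ← div_eq_mul_inv, ← Real.div_rpow (by positivity) hQ.le]
        exact Real.one_le_rpow ((one_le_div hQ).2 (by nlinarith [norm_nonneg x])) hp0.le
      calc |u x| ^ p * ‖x‖ ^ (-p) ≤
          |u x| ^ p * ‖x‖ ^ (-p) * ((R ^ 2) ^ p * (R ^ 2 - ‖x‖ ^ 2) ^ (-p)) :=
            le_mul_of_one_le_right (by positivity) h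
        _ = _ := by ring
    · simp [hu.eq_zero hx, Real.zero_rpow hp0.ne']
  have hpt (x : Euc N) : ENNReal.ofReal (|u x| ^ pstar N p s * ‖x‖ ^ (-s)) =
      ENNReal.ofReal (|u x| ^ p * ‖x‖ ^ (-p)) ^ θ *
        ENNReal.ofReal (|u x| ^ (p * N / (N - p))) ^ (1 - θ) := by
    rw [ENNReal.ofReal_rpow_of_nonneg (by positivity) hθ0,
      ENNReal.ofReal_rpow_of_nonneg (by positivity) hθ1, ← ENNReal.ofReal_mul (by positivity),
      Real.mul_rpow (by positivity) (by positivity), ← Real.rpow_mul (abs_nonneg _),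
      ← Real.rpow_mul (norm_nonneg _), ← Real.rpow_mul (abs_nonneg _), mul_right_comm,
      ← Real.rpow_add_of_nonneg (abs_nonneg _) (by positivity) (by positivity)]
    congr 3
    · rw [pstar, hθ]; field_simp; ring
    · rw [hθ]; field_simp
  simp_rw [hpt]
  calc _ ≤ _ := ENNReal.lintegral_mul_norm_pow_le (by fun_prop) (by fun_prop) hθ0 hθ1 (by ring)
    _ ≤ ENNReal.ofReal ((R ^ 2) ^ p * C₁ * gradEn N p R u) ^ θ *
        ENNReal.ofReal (C₂ * gradEn N p R u ^ ((N : ℝ) / (N - p))) ^ (1 - θ) := by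
      gcongr
      exact h₂ u hu
    _ = _ := by
      rw [ENNReal.ofReal_rpow_of_nonneg (by positivity) hθ0,
        ENNReal.ofReal_rpow_of_nonneg (by positivity) hθ1, ← ENNReal.ofReal_mul (by positivity),
        Real.mul_rpow (by positivity) hE0, Real.mul_rpow hC₂.le (by positivity),
        ← Real.rpow_mul hE0, mul_mul_mul_comm,
        ← Real.rpow_add_of_nonneg hE0 hθ0 (by positivity)]
      congr 3
      rw [pstar, hθ]; field_simp; ring

/-- The weighted integral of a test function is controlled by its energy. -/
lemma exists_lintegral_Va_le {N : ℕ} {p s R a : ℝ} (hN : 2 ≤ N) (hp : 1 < p) (hpN : p < N)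
    (hs : 0 ≤ s) (hsp : s ≤ p) (hR : 0 < R) (ha : a ∈ Icc (0 : ℝ) 1)
    (has : a = 1 → s = p) :
    ∃ C : ℝ, 0 < C ∧ ∀ u, IsTest N R u →
      ∫⁻ x in ball (0 : Euc N) R, ENNReal.ofReal (|u x| ^ pstar N p s * Va N p s R a x) ≤
        ENNReal.ofReal (C * gradEn N p R u ^ (pstar N p s / p)) := by
  have hp0 : 0 < p := by linarith
  suffices h : ∃ K C : ℝ, 0 < K ∧ 0 < C ∧ ∃ W : Euc N → ℝ,
      (∀ x ∈ ball (0 : Euc N) R, Va N p s R a x ≤ K * W x) ∧ ∀ u, IsTest N R u →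
        ∫⁻ x, ENNReal.ofReal (|u x| ^ pstar N p s * W x) ≤
          ENNReal.ofReal (C * gradEn N p R u ^ (pstar N p s / p)) by
    obtain ⟨K, C, hK, hC, W, hW, h⟩ := h
    refine ⟨K * C, by positivity, fun u hu => ?_⟩
    rw [mul_assoc, ENNReal.ofReal_mul hK.le]
    refine le_trans ?_ (mul_le_mul_right (h u hu) _)
    rw [← lintegral_const_mul' _ _ ENNReal.ofReal_ne_top]
    refine le_trans (setLIntegral_mono' measurableSet_ball fun x hx => ?_)
      (setLIntegral_le_lintegral (ball (0 : Euc N) R) _)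
    rw [← ENNReal.ofReal_mul hK.le, mul_left_comm]
    exact ENNReal.ofReal_le_ofReal (mul_le_mul_of_nonneg_left (hW x hx) (by positivity))
  rcases ha.2.eq_or_lt with h1 | h1
  · obtain rfl := has h1
    obtain ⟨K, hK, hW⟩ := exists_Va_le hp hpN hR ha
    obtain ⟨C, hC, h⟩ := hardy_lintegral hp hpN hR
    have hps : pstar N s s = s := mul_div_cancel_right₀ _ (by linarith)
    refine ⟨K, C, hK, hC, _, hW, fun u hu => ?_⟩
    simpa [hps, div_self hp0.ne'] using h u hu
  · obtain ⟨C, hC, h⟩ := hardySobolev_lintegral hN hp hpN hs hsp hR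
    exact ⟨_, C, Real.rpow_pos_of_pos (by linarith) _, hC, _,
      fun x hx => Va_le_of_lt_one hp hpN hsp hR ha.1 h1 hx, h⟩

lemma integral_Va_pos {N : ℕ} {p s R a : ℝ} (hN : 2 ≤ N) (hp : 1 < p) (hpN : p < N)
    (hR : 0 < R) (ha : a ∈ Icc (0 : ℝ) 1) {u : Euc N → ℝ} (hu : IsTest N R u) (hu0 : u ≠ 0)
    (hint : IntegrableOn (fun x => |u x| ^ pstar N p s * Va N p s R a x)
      (ball (0 : Euc N) R)) :
    0 < ∫ x in ball (0 : Euc N) R, |u x| ^ pstar N p s * Va N p s R a x := by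
  have : Nonempty (Fin N) := ⟨⟨0, by omega⟩⟩
  have hnn : 0 ≤ᵐ[volume.restrict (ball (0 : Euc N) R)]
      fun x => |u x| ^ pstar N p s * Va N p s R a x := by
    filter_upwards [ae_restrict_mem measurableSet_ball] with x hx
    exact mul_nonneg (by positivity) (Va_nonneg hp hpN hR ha hx)
  rw [integral_pos_iff_support_of_nonneg_ae hnn hint, Measure.restrict_apply' measurableSet_ball]
  have hopen : IsOpen (Function.support u) := hu.1.continuous.isOpen_support
  have hpos : 0 < volume (Function.support u) :=
    hopen.measure_pos _ (Function.support_nonempty_iff.2 hu0)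
  rw [← measure_sdiff_null (measure_singleton (0 : Euc N))] at hpos
  refine hpos.trans_le (measure_mono fun x hx => ?_)
  have hxb : x ∈ ball (0 : Euc N) R := by
    by_contra h
    exact hx.1 (hu.eq_zero h)
  have hx0 : 0 < ‖x‖ := norm_pos_iff.2 hx.2
  have hux : 0 < |u x| := abs_pos.2 hx.1
  have := weight_base_pos hp hpN hR ha hxb
  refine ⟨ne_of_gt ?_, hxb⟩
  simp only [Va]
  positivity

lemma exists_le_quotV {N : ℕ} {p s R a : ℝ} (hN : 2 ≤ N) (hp : 1 < p) (hpN : p < N)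
    (hs : 0 ≤ s) (hsp : s ≤ p) (hR : 0 < R) (ha : a ∈ Icc (0 : ℝ) 1)
    (has : a = 1 → s = p) :
    ∃ c : ℝ, 0 < c ∧ ∀ u, IsTest N R u → u ≠ 0 → c ≤ quotV N p s R a u := by
  have hp0 : 0 < p := by linarith
  have hps := pstar_pos (s := s) hp hpN hsp
  obtain ⟨C, hC, h⟩ := exists_lintegral_Va_le hN hp hpN hs hsp hR ha has
  refine ⟨(C ^ (p / pstar N p s))⁻¹, by positivity, fun u hu hu0 => ?_⟩
  have hE0 : 0 ≤ gradEn N p R u := integral_nonneg fun x => by positivity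
  have hm : AEStronglyMeasurable (fun x => |u x| ^ pstar N p s * Va N p s R a x)
      (volume.restrict (ball (0 : Euc N) R)) := by
    have hum : Measurable u := hu.1.continuous.measurable
    have := measurable_Va (N := N) (p := p) (s := s) (R := R) (a := a)
    exact Measurable.aestronglyMeasurable (by fun_prop)
  have hnn : 0 ≤ᵐ[volume.restrict (ball (0 : Euc N) R)]
      fun x => |u x| ^ pstar N p s * Va N p s R a x := by
    filter_upwards [ae_restrict_mem measurableSet_ball] with x hx
    exact mul_nonneg (by positivity) (Va_nonneg hp hpN hR ha hx)
  have hint : IntegrableOn (fun x => |u x| ^ pstar N p s * Va N p s R a x)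
      (ball (0 : Euc N) R) :=
    ⟨hm, (hasFiniteIntegral_iff_ofReal hnn).2 ((h u hu).trans_lt ENNReal.ofReal_lt_top)⟩
  have hJ := integral_Va_pos hN hp hpN hR ha hu hu0 hint
  have hJle : ∫ x in ball (0 : Euc N) R, |u x| ^ pstar N p s * Va N p s R a x ≤
      C * gradEn N p R u ^ (pstar N p s / p) := by
    rw [integral_eq_lintegral_of_nonneg_ae hnn hm]
    exact ENNReal.toReal_le_of_le_ofReal (by positivity) (h u hu)
  have hden : denomV N p s R a u ≤ C ^ (p / pstar N p s) * gradEn N p R u := by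
    refine (Real.rpow_le_rpow hJ.le hJle (by positivity)).trans_eq ?_
    rw [Real.mul_rpow hC.le (by positivity), ← Real.rpow_mul hE0,
      div_mul_div_cancel₀ hp0.ne', div_self hps.ne', Real.rpow_one]
  have hden0 : 0 < denomV N p s R a u := Real.rpow_pos_of_pos hJ _
  rw [quotV, le_div_iff₀ hden0, inv_mul_le_iff₀ (by positivity)]
  exact hden

/-- The rescaling of a fixed bump function to the ball of radius `ε` around `y`. -/
def scaledBump {N : ℕ} (φ : ContDiffBump (0 : Euc N)) (y : Euc N) (ε : ℝ) (x : Euc N) : ℝ :=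
  φ (ε⁻¹ • (x - y))

section ScaledBump

variable {N : ℕ} {φ : ContDiffBump (0 : Euc N)} {y : Euc N} {ε : ℝ}

lemma tsupport_scaledBump_subset (hφ : φ.rOut = 1) (hε : 0 < ε) :
    tsupport (scaledBump φ y ε) ⊆ closedBall y ε := by
  refine closure_minimal (fun x hx => ?_) isClosed_closedBall
  have h : ε⁻¹ • (x - y) ∈ Function.support φ := hx
  rw [φ.support_eq, hφ, mem_ball_zero_iff, norm_smul, norm_inv, Real.norm_of_nonneg hε.le,
    inv_mul_lt_iff₀ hε, mul_one] at h
  rw [mem_closedBall, dist_eq_norm]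
  exact h.le

lemma scaledBump_eq_one (hφ : φ.rIn = 1 / 2) (hε : 0 < ε) {x : Euc N}
    (hx : x ∈ closedBall y (ε / 2)) : scaledBump φ y ε x = 1 := by
  refine φ.one_of_mem_closedBall ?_
  rw [mem_closedBall, dist_eq_norm] at hx
  rw [hφ, mem_closedBall_zero_iff, norm_smul, norm_inv, Real.norm_of_nonneg hε.le,
    inv_mul_le_iff₀ hε]
  linarith

lemma isTest_scaledBump {R : ℝ} (hφ : φ.rOut = 1) (hε : 0 < ε)
    (hy : closedBall y ε ⊆ ball (0 : Euc N) R) : IsTest N R (scaledBump φ y ε) := by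
  have hsub := tsupport_scaledBump_subset (y := y) hφ hε
  refine ⟨φ.contDiff.comp (by fun_prop : ContDiff ℝ (⊤ : ℕ∞) fun x : Euc N => ε⁻¹ • (x - y)), ?_,
    hsub.trans hy⟩
  exact (isCompact_closedBall y ε).of_isClosed_subset (isClosed_tsupport _) hsub

lemma gradEn_scaledBump_le {p R : ℝ} {K : NNReal} (hp : 0 < p) (hφ : φ.rOut = 1)
    (hK : LipschitzWith K φ) (hε : 0 < ε) (hy : closedBall y ε ⊆ ball (0 : Euc N) R) :
    gradEn N p R (scaledBump φ y ε) ≤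
      (K / ε) ^ p * (ε ^ N * volume.real (ball (0 : Euc N) 1)) := by
  have hu := isTest_scaledBump hφ hε hy
  have hlip : LipschitzWith (K * Real.toNNReal ε⁻¹) (scaledBump φ y ε) := by
    refine hK.comp (LipschitzWith.of_dist_le_mul fun x z => ?_)
    rw [dist_smul₀, dist_sub_right, Real.coe_toNNReal _ (by positivity),
      Real.norm_of_nonneg (by positivity)]
  have hbound (x : Euc N) : ‖fderiv ℝ (scaledBump φ y ε) x‖ ≤ K / ε := by
    refine (norm_fderiv_le_of_lipschitz ℝ hlip).trans_eq ?_
    rw [NNReal.coe_mul, Real.coe_toNNReal _ (by positivity), div_eq_mul_inv]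
  have hsupp : ∀ x ∉ closedBall y ε, ‖fderiv ℝ (scaledBump φ y ε) x‖ ^ p = 0 := fun x hx => by
    rw [(notMem_tsupport_iff_eventuallyEq.1 fun h =>
      hx (tsupport_scaledBump_subset hφ hε h)).fderiv_eq]
    simp [Real.zero_rpow hp.ne']
  rw [hu.gradEn_eq hp, ← setIntegral_eq_integral_of_forall_compl_eq_zero hsupp]
  have hvol : volume.real (closedBall y ε) = ε ^ N * volume.real (ball (0 : Euc N) 1) := by
    rw [Measure.addHaar_real_closedBall _ _ hε.le]; simp
  rw [← hvol]
  refine (Real.le_norm_self _).trans ?_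
  refine norm_setIntegral_le_of_norm_le_const
    (μ := volume) (isCompact_closedBall y ε).measure_lt_top
    fun x _ => ?_
  rw [Real.norm_of_nonneg (by positivity)]
  exact Real.rpow_le_rpow (norm_nonneg _) (hbound x) hp.le

end ScaledBump

lemma Va_one_ge {N : ℕ} {p s R ε : ℝ} (hp : 1 < p) (hpN : p < N) (hs : 0 ≤ s) (hsp : s ≤ p)
    (hR : 0 < R) {x : Euc N} (hx0 : x ≠ 0) (hx : x ∈ ball (0 : Euc N) R)
    (hxε : R - 3 * ε ≤ ‖x‖) :
    R ^ (-s) * (max 1 (((N : ℝ) - p) / (p - 1)) * (3 / R) * ε) ^ (-beta N p s) ≤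
      Va N p s R 1 x := by
  have hxR := mem_ball_zero_iff.1 hx
  have hb := weight_base_pos hp hpN hR (right_mem_Icc.2 zero_le_one) hx
  have hle := one_sub_rpow_le (α := ((N : ℝ) - p) / (p - 1)) (t := ‖x‖ / R) (by positivity)
    ((div_le_one hR).2 hxR.le)
  have ht : 1 - ‖x‖ / R ≤ 3 / R * ε := by
    rw [div_mul_eq_mul_div, sub_le_iff_le_add, ← add_div, le_div_iff₀ hR]; linarith
  have hxn : 0 < ‖x‖ := norm_pos_iff.2 hx0
  have hβ := beta_pos hp hpN hsp
  refine mul_le_mul (Real.rpow_le_rpow_of_nonpos hxn hxR.le (by linarith))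
    (Real.rpow_le_rpow_of_nonpos hb ?_ (by linarith)) ?_ (by positivity)
  · rw [one_mul, mul_assoc]
    exact hle.trans (mul_le_mul_of_nonneg_left ht (by positivity))
  · exact Real.rpow_nonneg (hb.le.trans (by
      rw [one_mul, mul_assoc]
      exact hle.trans (mul_le_mul_of_nonneg_left ht (by positivity)))) _

lemma integral_scaledBump_Va_ge {N : ℕ} {p s R ε : ℝ} {φ : ContDiffBump (0 : Euc N)}
    {y : Euc N} (hp : 1 < p) (hpN : p < N) (hs : 0 ≤ s) (hsp : s ≤ p) (hε : 0 < ε)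
    (hεR : 4 * ε ≤ R) (hin : φ.rIn = 1 / 2) (hout : φ.rOut = 1) (hy : ‖y‖ = R - 2 * ε) :
    R ^ (-s) * (max 1 (((N : ℝ) - p) / (p - 1)) * (3 / R) * ε) ^ (-beta N p s) *
        ((ε / 2) ^ N * volume.real (ball (0 : Euc N) 1)) ≤
      ∫ x in ball (0 : Euc N) R, |scaledBump φ y ε x| ^ pstar N p s * Va N p s R 1 x := by
  have hR : 0 < R := by linarith
  have hps := pstar_pos (s := s) hp hpN hsp
  have hnorm {x : Euc N} (hx : x ∈ closedBall y ε) : R - 3 * ε ≤ ‖x‖ ∧ ‖x‖ ≤ R - ε := by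
    rw [mem_closedBall, dist_eq_norm] at hx
    have h1 := norm_sub_norm_le x y
    have h2 := norm_sub_norm_le y x
    rw [norm_sub_rev] at h2
    constructor <;> linarith
  have hyb : closedBall y ε ⊆ ball (0 : Euc N) R := fun x hx => by
    rw [mem_ball_zero_iff]; linarith [(hnorm hx).2]
  have hne {x : Euc N} (hx : x ∈ closedBall y ε) : ‖x‖ ≠ 0 := by
    linarith [(hnorm hx).1, (by linarith : 0 < R - 3 * ε)] |> ne_of_gt
  have hu := isTest_scaledBump hout hε hyb
  have hcont : ContinuousOn (fun x => |scaledBump φ y ε x| ^ pstar N p s * Va N p s R 1 x)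
      (closedBall y ε) := by
    refine ContinuousOn.mul ?_ (ContinuousOn.mul ?_ ?_)
    · exact (hu.1.continuous.abs.rpow_const fun _ => Or.inr hps.le).continuousOn
    · exact continuous_norm.continuousOn.rpow_const fun x hx => Or.inl (hne hx)
    · refine ContinuousOn.rpow_const ?_ fun x hx => Or.inl
        (weight_base_pos hp hpN hR (right_mem_Icc.2 zero_le_one) (hyb hx)).ne'
      refine Continuous.continuousOn ?_
      refine continuous_const.sub (continuous_const.mul ?_)
      exact (continuous_norm.div_const R).rpow_const fun _ =>
        Or.inr (div_pos (by linarith) (by linarith)).le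
  have hint : Integrable (fun x => |scaledBump φ y ε x| ^ pstar N p s * Va N p s R 1 x) := by
    refine (integrableOn_iff_integrable_of_support_subset fun x hx => ?_).1
      (hcont.integrableOn_compact (isCompact_closedBall y ε))
    by_contra h
    refine hx ?_
    simp only
    rw [image_eq_zero_of_notMem_tsupport fun h' => h (tsupport_scaledBump_subset hout hε h')]
    simp [Real.zero_rpow hps.ne']
  have hsub : closedBall y (ε / 2) ⊆ closedBall y ε := closedBall_subset_closedBall (by linarith)
  have hvol : volume.real (closedBall y (ε / 2)) =
      (ε / 2) ^ N * volume.real (ball (0 : Euc N) 1) := by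
    rw [Measure.addHaar_real_closedBall _ _ (by positivity)]; simp
  calc _ = ∫ _x in closedBall y (ε / 2), R ^ (-s) *
        (max 1 (((N : ℝ) - p) / (p - 1)) * (3 / R) * ε) ^ (-beta N p s) := by
        rw [setIntegral_const, hvol, smul_eq_mul, mul_comm]
    _ ≤ ∫ x in closedBall y (ε / 2), |scaledBump φ y ε x| ^ pstar N p s * Va N p s R 1 x := by
        refine setIntegral_mono_on
          (integrableOn_const (isCompact_closedBall y (ε / 2)).measure_lt_top.ne)
          hint.integrableOn measurableSet_closedBall fun x hx => ?_
        rw [scaledBump_eq_one hin hε hx, abs_one, Real.one_rpow, one_mul]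
        exact Va_one_ge hp hpN hs hsp hR (norm_ne_zero_iff.1 (hne (hsub hx))) (hyb (hsub hx))
          (hnorm (hsub hx)).1
    _ ≤ _ := by
        refine setIntegral_mono_set hint.integrableOn ?_ (hsub.trans hyb).eventuallyLE
        filter_upwards [ae_restrict_mem measurableSet_ball] with x hx
        exact mul_nonneg (by positivity)
          (Va_nonneg hp hpN hR (right_mem_Icc.2 zero_le_one) hx)

lemma exponent_pos {N : ℕ} {p s : ℝ} (hp : 1 < p) (hpN : p < N) (hsp : s < p) :
    0 < (N : ℝ) - p - (N - beta N p s) * (p / pstar N p s) := by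
  have hNp : 0 < (N : ℝ) - p := by linarith
  have hNs : 0 < (N : ℝ) - s := by linarith
  have : (N : ℝ) - p - (N - beta N p s) * (p / pstar N p s) =
      ((N : ℝ) - 1) * (p - s) / (N - s) := by
    rw [beta, pstar]; field_simp; ring
  rw [this]
  exact div_pos (mul_pos (by linarith) (by linarith)) hNs

lemma exists_quotV_le {N : ℕ} {p s R : ℝ} (hN : 2 ≤ N) (hp : 1 < p) (hpN : p < N) (hs : 0 ≤ s)
    (hsp : s ≤ p) (hR : 0 < R) :
    ∃ M : ℝ, ∀ ε > 0, 4 * ε ≤ R → ∃ u, IsTest N R u ∧ u ≠ 0 ∧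
      quotV N p s R 1 u ≤ M * ε ^ ((N : ℝ) - p - (N - beta N p s) * (p / pstar N p s)) := by
  have : Nonempty (Fin N) := ⟨⟨0, by omega⟩⟩
  have hps := pstar_pos (s := s) hp hpN hsp
  have hp0 : 0 < p := by linarith
  let φ : ContDiffBump (0 : Euc N) := ⟨1 / 2, 1, by norm_num, by norm_num⟩
  obtain ⟨K, hK⟩ := ContDiff.lipschitzWith_of_hasCompactSupport φ.hasCompactSupport
    (φ.contDiff (n := 1)) one_ne_zero
  obtain ⟨e, he⟩ := exists_norm_eq (Euc N) zero_le_one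
  set ω := volume.real (ball (0 : Euc N) 1) with hω
  have hω0 : 0 < ω := ENNReal.toReal_pos (measure_ball_pos _ _ one_pos).ne' measure_ball_lt_top.ne
  set L : ℝ := max 1 (((N : ℝ) - p) / (p - 1)) * (3 / R) with hL
  have hL0 : 0 < L := by positivity
  set θ : ℝ := p / pstar N p s with hθ
  set β : ℝ := beta N p s with hβ
  refine ⟨(K : ℝ) ^ p * ω / (R ^ (-s) * L ^ (-β) * ((1 / 2) ^ N * ω)) ^ θ, fun ε hε hεR =>
    ⟨scaledBump φ ((R - 2 * ε) • e) ε, ?_⟩⟩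
  have hy : ‖(R - 2 * ε) • e‖ = R - 2 * ε := by
    rw [norm_smul, he, mul_one, Real.norm_of_nonneg (by linarith)]
  set y := (R - 2 * ε) • e with hydef
  have hyb : closedBall y ε ⊆ ball (0 : Euc N) R := by
    refine closedBall_subset_ball' ?_
    rw [dist_zero_right, hy]; linarith
  refine ⟨isTest_scaledBump rfl hε hyb, fun h => ?_, ?_⟩
  · have := scaledBump_eq_one (φ := φ) rfl hε (mem_closedBall_self (x := y) (by positivity))
    simp [h] at this
  have hJ := integral_scaledBump_Va_ge (φ := φ) hp hpN hs hsp hε hεR rfl rfl hy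
  have hG := gradEn_scaledBump_le (φ := φ) hp0 rfl hK hε hyb
  rw [← hL, ← hω, ← hβ] at hJ
  rw [← hω] at hG
  have hlow : R ^ (-s) * (L * ε) ^ (-β) * ((ε / 2) ^ N * ω) =
      R ^ (-s) * L ^ (-β) * ((1 / 2) ^ N * ω) * ε ^ ((N : ℝ) - β) := by
    rw [Real.mul_rpow hL0.le hε.le, sub_eq_add_neg, Real.rpow_add hε, Real.rpow_natCast, div_pow,
      div_pow, one_pow]
    ring
  have hup : ((K : ℝ) / ε) ^ p * (ε ^ N * ω) = (K : ℝ) ^ p * ω * ε ^ ((N : ℝ) - p) := by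
    rw [Real.div_rpow K.coe_nonneg hε.le, Real.rpow_sub hε, Real.rpow_natCast]
    ring
  rw [hlow] at hJ
  rw [hup] at hG
  set D : ℝ := R ^ (-s) * L ^ (-β) * ((1 / 2) ^ N * ω) with hD
  have hD0 : 0 < D := by positivity
  have hden : D ^ θ * ε ^ (((N : ℝ) - β) * θ) ≤ denomV N p s R 1 (scaledBump φ y ε) := by
    rw [Real.rpow_mul hε.le, ← Real.mul_rpow hD0.le (by positivity)]
    exact Real.rpow_le_rpow (by positivity) hJ (by positivity)
  calc quotV N p s R 1 (scaledBump φ y ε)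
      ≤ (K : ℝ) ^ p * ω * ε ^ ((N : ℝ) - p) / (D ^ θ * ε ^ (((N : ℝ) - β) * θ)) :=
        div_le_div₀ (by positivity) hG (by positivity) hden
    _ = _ := by
        rw [Real.rpow_sub hε ((N : ℝ) - p), mul_div_mul_comm]

lemma quotV_nonneg {N : ℕ} {p s R a : ℝ} (hp : 1 < p) (hpN : p < N) (hR : 0 < R)
    (ha : a ∈ Icc (0 : ℝ) 1) (u : Euc N → ℝ) : 0 ≤ quotV N p s R a u :=
  div_nonneg (integral_nonneg fun x => by positivity)
    (Real.rpow_nonneg (setIntegral_nonneg measurableSet_ball fun x hx =>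
      mul_nonneg (by positivity) (Va_nonneg hp hpN hR ha hx)) _)

lemma exists_isTest_ne_zero (N : ℕ) {R : ℝ} (hR : 0 < R) :
    ∃ u : Euc N → ℝ, IsTest N R u ∧ u ≠ 0 := by
  let φ : ContDiffBump (0 : Euc N) := ⟨1 / 2, 1, by norm_num, by norm_num⟩
  refine ⟨scaledBump φ 0 (R / 2), isTest_scaledBump rfl (by positivity)
    (closedBall_subset_ball (by linarith)), fun h => ?_⟩
  have := scaledBump_eq_one (φ := φ) (ε := R / 2) rfl (by positivity)
    (mem_closedBall_self (x := 0) (by positivity))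
  simp [h] at this

end HS

/-- positivity criterion : `I_a = 0` iff `a = 1` and `0 ≤ s < p`. -/
theorem Ia_eq_zero_iff (N : ℕ) (p s R a : ℝ) (hN : 2 ≤ N) (hp : 1 < p)
    (hpN : p < (N : ℝ)) (hs : 0 ≤ s) (hsp : s ≤ p) (hR : 0 < R)
    (ha : a ∈ Icc (0 : ℝ) 1) :
    HS.Ia N p s R a = 0 ↔ (a = 1 ∧ s < p) := by
  constructor
  · intro h
    by_contra hcon
    obtain ⟨c, hc, hle⟩ := HS.exists_le_quotV hN hp hpN hs hsp hR ha fun h1 =>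
      le_antisymm hsp (not_lt.1 fun hlt => hcon ⟨h1, hlt⟩)
    have : c ≤ HS.Ia N p s R a := by
      refine le_csInf (Set.Nonempty.image _ (HS.exists_isTest_ne_zero N hR)) ?_
      rintro _ ⟨u, ⟨hu, hu0⟩, rfl⟩
      exact hle u hu hu0
    linarith
  · rintro ⟨rfl, hlt⟩
    have hnn : ∀ q ∈ HS.quotV N p s R 1 '' {u | HS.IsTest N R u ∧ u ≠ 0}, 0 ≤ q := by
      rintro _ ⟨u, -, rfl⟩
      exact HS.quotV_nonneg hp hpN hR ha u
    refine le_antisymm ?_ (Real.sInf_nonneg hnn)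
    obtain ⟨M, hM⟩ := HS.exists_quotV_le hN hp hpN hs hsp hR
    have hκ := HS.exponent_pos hp hpN hlt
    set κ := (N : ℝ) - p - (N - HS.beta N p s) * (p / HS.pstar N p s)
    have hlim : Tendsto (fun ε : ℝ => M * ε ^ κ) (nhdsWithin 0 (Ioi 0)) (nhds 0) := by
      have h0 : Tendsto (fun ε : ℝ => M * ε ^ κ) (nhds 0) (nhds (M * 0 ^ κ)) :=
        (Real.continuousAt_rpow_const 0 κ (Or.inr hκ.le)).tendsto.const_mul M
      rw [Real.zero_rpow hκ.ne', mul_zero] at h0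
      exact h0.mono_left nhdsWithin_le_nhds
    refine ge_of_tendsto hlim ?_
    filter_upwards [Ioc_mem_nhdsGT (by positivity : 0 < R / 4)] with ε hε
    obtain ⟨u, hu, hu0, hle⟩ := hM ε hε.1 (by linarith [hε.2])
    exact (csInf_le ⟨0, hnn⟩ ⟨u, ⟨hu, hu0⟩, rfl⟩).trans hle
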